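/- Let σ ⊆ ℝ² be a (d,k)-cone (d > k > 0, gcd(d,k) = 1) and write the Hirzebruch–Jung expansion d/k = [b₁,…,b_r]⁻. Then RSV(σ) = 2 + Σ_{i=1}^{r} (b_i − 2). Equivalently, the local Euler obstruction Eu(v) = 2 − RSV(σ) of the torus-fixed point v of the affine toric surface whose dual cone is σ equals Σ_{i=1}^{r} (2 − b_i). -/

import Mathlib

open MeasureTheory

/-- The standard lattice `ℤ²` inside `ℝ²`. -/
def Lat2 : Set (Fin 2 → ℝ) := {x | ∀ j, ∃ m : ℤ, x j = (m : ℝ)}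

/-- `{e₁, e₂}` is a ℤ-basis of the lattice `ℤ² ⊆ ℝ²`, i.e. the two vectors are lattice
vectors generating `ℤ²` as a ℤ-module. -/
def IsZBasis (e₁ e₂ : Fin 2 → ℝ) : Prop :=
  e₁ ∈ Lat2 ∧ e₂ ∈ Lat2 ∧ ∀ x ∈ Lat2, ∃ a b : ℤ, x = a • e₁ + b • e₂

/-- `u` is a primitive lattice vector: its (integer) coordinates have gcd `1`. -/
def IsPrimitive (u : Fin 2 → ℝ) : Prop :=
  ∃ a b : ℤ, u 0 = (a : ℝ) ∧ u 1 = (b : ℝ) ∧ Int.gcd a b = 1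

/-- The cone spanned by two vectors: `Cone(u,v) = ℝ≥0·u + ℝ≥0·v`. -/
def coneTwo (u v : Fin 2 → ℝ) : Set (Fin 2 → ℝ) :=
  {x | ∃ a b : ℝ, 0 ≤ a ∧ 0 ≤ b ∧ x = a • u + b • v}

/-- Matsui–Takeuchi's normalized relative subdiagram volume of a plane cone `σ` at its
apex: twice the Lebesgue measure of `σ ∖ conv((σ ∖ {0}) ∩ ℤ²)`. -/
noncomputable def RSV (σ : Set (Fin 2 → ℝ)) : ℝ :=
  2 * (volume (σ \ convexHull ℝ ((σ \ {0}) ∩ Lat2))).toReal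

/-- Hirzebruch–Jung continued fraction expansion of `d/k`. -/
def hjList (d k : ℕ) : List ℕ :=
  if h : k ≤ 1 then [d]
  else
    (d + k - 1) / k :: hjList k ((d + k - 1) / k * k - d)
termination_by k
decreasing_by
  have h1 : (d + k - 1) / k * k ≤ d + k - 1 := Nat.div_mul_le_self _ _
  omega

/-- The (un-normalized) area of the subdiagram region. -/
noncomputable def subArea (σ : Set (Fin 2 → ℝ)) : ENNReal :=
  volume (σ \ convexHull ℝ ((σ \ {0}) ∩ Lat2))

lemma lat2_mk (a b : ℤ) : (![(a : ℝ), (b : ℝ)] : Fin 2 → ℝ) ∈ Lat2 := by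
  intro j
  fin_cases j
  · exact ⟨a, rfl⟩
  · exact ⟨b, rfl⟩

/-- Invariance under unimodular coordinate changes. -/
lemma subArea_basis (e₁ e₂ : Fin 2 → ℝ) (hB : IsZBasis e₁ e₂) (s t p q : ℝ) :
    subArea (coneTwo (s • e₁ + t • e₂) (p • e₁ + q • e₂)) =
      subArea (coneTwo ![s, t] ![p, q]) := by
  obtain ⟨h1, h2, h3⟩ := hB
  obtain ⟨a, ha⟩ := h1 0
  obtain ⟨c, hc⟩ := h1 1
  obtain ⟨b, hb⟩ := h2 0
  obtain ⟨e, he⟩ := h2 1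
  obtain ⟨x, y, hxy⟩ := h3 ![((1 : ℤ) : ℝ), ((0 : ℤ) : ℝ)] (lat2_mk 1 0)
  obtain ⟨z, w, hzw⟩ := h3 ![((0 : ℤ) : ℝ), ((1 : ℤ) : ℝ)] (lat2_mk 0 1)
  have e1 := congrFun hxy 0
  have e2 := congrFun hxy 1
  have e3 := congrFun hzw 0
  have e4 := congrFun hzw 1
  simp [ha, hb, hc, he] at e1 e2 e3 e4
  norm_cast at e1 e2 e3 e4
  have hdet : (a * e - b * c) * (x * w - y * z) = 1 := by
    have : (a * e - b * c) * (x * w - y * z) =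
      (x * a + y * b) * (z * c + w * e) - (x * c + y * e) * (z * a + w * b) := by ring
    rw [this, ← e1, ← e2, ← e3, ← e4]; norm_num
  have hu : IsUnit (a * e - b * c) := IsUnit.of_mul_eq_one _ hdet
  set M : Matrix (Fin 2) (Fin 2) ℝ := !![(a : ℝ), b; c, e] with hM
  have hMd : M.det = ((a * e - b * c : ℤ) : ℝ) := by
    rw [hM, Matrix.det_fin_two_of]; push_cast; ring
  have habs : |M.det| = 1 := by
    rw [hMd]
    rcases Int.isUnit_iff.mp hu with h | h <;> rw [h] <;> norm_num
  set L : (Fin 2 → ℝ) →ₗ[ℝ] (Fin 2 → ℝ) := Matrix.toLin' M with hL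
  have hLx : ∀ v, L v = v 0 • e₁ + v 1 • e₂ := by
    intro v
    ext j
    fin_cases j
    · simp [hL, hM, Matrix.mulVec, dotProduct, Fin.sum_univ_two, ha, hb]; ring
    · simp [hL, hM, Matrix.mulVec, dotProduct, Fin.sum_univ_two, hc, he]; ring
  have hLd : L.det = M.det := LinearMap.det_toLin' M
  have hinj : Function.Injective L := by
    have : M.det ≠ 0 := by intro h; rw [h] at habs; norm_num at habs
    rw [hL]
    exact Matrix.mulVec_injective_iff_isUnit.mpr
      ((Matrix.isUnit_iff_isUnit_det _).mpr (isUnit_iff_ne_zero.mpr this))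
  have hLat : L '' Lat2 = Lat2 := by
    ext v
    constructor
    · rintro ⟨v, hv, rfl⟩
      obtain ⟨m, hm⟩ := hv 0
      obtain ⟨n, hn⟩ := hv 1
      rw [hLx, hm, hn]
      intro j
      fin_cases j
      · exact ⟨m * a + n * b, by simp [ha, hb]⟩
      · exact ⟨m * c + n * e, by simp [hc, he]⟩
    · intro hv
      obtain ⟨m, n, hmn⟩ := h3 v hv
      refine ⟨![(m : ℝ), (n : ℝ)], lat2_mk m n, ?_⟩
      rw [hLx, hmn]
      ext j
      simp
  have hcone : L '' (coneTwo ![s, t] ![p, q]) =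
      coneTwo (s • e₁ + t • e₂) (p • e₁ + q • e₂) := by
    have l1 : L ![s, t] = s • e₁ + t • e₂ := by rw [hLx]; rfl
    have l2 : L ![p, q] = p • e₁ + q • e₂ := by rw [hLx]; rfl
    ext v
    constructor
    · rintro ⟨v, ⟨α, β, hα, hβ, rfl⟩, rfl⟩
      exact ⟨α, β, hα, hβ, by rw [map_add, map_smul, map_smul, l1, l2]⟩
    · rintro ⟨α, β, hα, hβ, rfl⟩
      exact ⟨_, ⟨α, β, hα, hβ, rfl⟩, by rw [map_add, map_smul, map_smul, l1, l2]⟩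
  unfold subArea
  rw [← hcone]
  have key : L '' (coneTwo ![s, t] ![p, q]) \
      convexHull ℝ ((L '' (coneTwo ![s, t] ![p, q]) \ {0}) ∩ Lat2) =
      L '' ((coneTwo ![s, t] ![p, q]) \
        convexHull ℝ (((coneTwo ![s, t] ![p, q]) \ {0}) ∩ Lat2)) := by
    rw [Set.image_diff hinj, LinearMap.image_convexHull, Set.image_inter hinj,
      Set.image_diff hinj, hLat, Set.image_singleton, map_zero]
  rw [key, Measure.addHaar_image_linearMap, hLd, habs]
  simp

lemma smul_mem_hull (S : Set (Fin 2 → ℝ)) (v : Fin 2 → ℝ)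
    (hS : ∀ n : ℕ, 1 ≤ n → (n : ℝ) • v ∈ S) (c : ℝ) (hc : 1 ≤ c) :
    c • v ∈ convexHull ℝ S := by
  obtain ⟨n, hn⟩ := exists_nat_gt c
  have hn1 : (1 : ℝ) < n := lt_of_le_of_lt hc hn
  have h1 : v ∈ convexHull ℝ S := subset_convexHull ℝ S (by simpa using hS 1 le_rfl)
  have h2 : (n : ℝ) • v ∈ convexHull ℝ S :=
    subset_convexHull ℝ S (hS n (by exact_mod_cast hn1.le))
  have hne : (n : ℝ) - 1 ≠ 0 := by linarith
  have := (convex_convexHull ℝ S) h1 h2 (a := (n - c) / (n - 1)) (b := (c - 1) / (n - 1))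
    (div_nonneg (by linarith) (by linarith)) (div_nonneg (by linarith) (by linarith))
    (by field_simp; ring)
  convert this using 1
  rw [smul_smul, ← add_smul]
  congr 1
  field_simp
  ring

lemma vol_tri : volume {x : Fin 2 → ℝ | 0 < x 0 ∧ 0 ≤ x 1 ∧ x 0 + x 1 < 1} =
    ENNReal.ofReal (1 / 2) := by
  have hmeas : MeasurableSet {x : ℝ × ℝ | 0 < x.1 ∧ 0 ≤ x.2 ∧ x.1 + x.2 < 1} := by
    refine MeasurableSet.inter ?_ (MeasurableSet.inter ?_ ?_)
    · exact measurableSet_lt measurable_const measurable_fst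
    · exact measurableSet_le measurable_const measurable_snd
    · exact measurableSet_lt (measurable_fst.add measurable_snd) measurable_const
  have h := (volume_preserving_finTwoArrow ℝ).measure_preimage hmeas.nullMeasurableSet
  have hpre : (MeasurableEquiv.finTwoArrow (α := ℝ)) ⁻¹'
      {x : ℝ × ℝ | 0 < x.1 ∧ 0 ≤ x.2 ∧ x.1 + x.2 < 1} =
      {x : Fin 2 → ℝ | 0 < x 0 ∧ 0 ≤ x 1 ∧ x 0 + x 1 < 1} := by
    ext x; simp [MeasurableEquiv.finTwoArrow]
  rw [← hpre, h, Measure.volume_eq_prod, Measure.prod_apply hmeas]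
  have hsl : ∀ x : ℝ, volume (Prod.mk x ⁻¹' {x : ℝ × ℝ | 0 < x.1 ∧ 0 ≤ x.2 ∧ x.1 + x.2 < 1}) =
      (Set.Ioc (0 : ℝ) 1).indicator (fun x => ENNReal.ofReal (1 - x)) x := by
    intro x
    by_cases hx : x ∈ Set.Ioc (0 : ℝ) 1
    · rw [Set.indicator_of_mem hx]
      have : Prod.mk x ⁻¹' {x : ℝ × ℝ | 0 < x.1 ∧ 0 ≤ x.2 ∧ x.1 + x.2 < 1} =
          Set.Ico 0 (1 - x) := by
        ext y
        simp only [Set.mem_preimage, Set.mem_setOf_eq, Set.mem_Ico]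
        constructor
        · rintro ⟨_, h2, h3⟩; exact ⟨h2, by linarith⟩
        · rintro ⟨h2, h3⟩; exact ⟨hx.1, h2, by linarith⟩
      rw [this, Real.volume_Ico, sub_zero]
    · rw [Set.indicator_of_notMem hx]
      have : Prod.mk x ⁻¹' {x : ℝ × ℝ | 0 < x.1 ∧ 0 ≤ x.2 ∧ x.1 + x.2 < 1} = ∅ := by
        ext y
        simp only [Set.mem_preimage, Set.mem_setOf_eq, Set.mem_empty_iff_false, iff_false]
        rintro ⟨h1, h2, h3⟩
        exact hx ⟨h1, by linarith⟩
      rw [this, measure_empty]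
  simp_rw [hsl]
  rw [lintegral_indicator measurableSet_Ioc, ← ofReal_integral_eq_lintegral_ofReal]
  · congr 1
    rw [← intervalIntegral.integral_of_le zero_le_one]
    rw [intervalIntegral.integral_sub (by simp) (by simp)]
    simp
    norm_num
  · exact (Continuous.integrableOn_Icc (by fun_prop)).mono_set Set.Ioc_subset_Icc_self
  · refine (ae_restrict_iff' measurableSet_Ioc).mpr (Filter.Eventually.of_forall ?_)
    intro x hx
    have := hx.2
    simp only [Pi.zero_apply]
    linarith

lemma meas_tri : MeasurableSet {x : Fin 2 → ℝ | 0 < x 0 ∧ 0 ≤ x 1 ∧ x 0 + x 1 < 1} := by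
  refine MeasurableSet.inter ?_ (MeasurableSet.inter ?_ ?_)
  · exact measurableSet_lt measurable_const (measurable_pi_apply 0)
  · exact measurableSet_le measurable_const (measurable_pi_apply 1)
  · exact measurableSet_lt ((measurable_pi_apply 0).add (measurable_pi_apply 1)) measurable_const

lemma mem_cone_e0 (p q : ℝ) (hq : 0 < q) (x : Fin 2 → ℝ) :
    x ∈ coneTwo ![1, 0] ![p, q] ↔ 0 ≤ x 1 ∧ p * x 1 ≤ q * x 0 := by
  constructor
  · rintro ⟨a, b, ha, hb, rfl⟩
    simp
    constructor
    · positivity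
    · nlinarith [mul_nonneg ha hq.le]
  · rintro ⟨h1, h2⟩
    refine ⟨x 0 - p * x 1 / q, x 1 / q, ?_, by positivity, ?_⟩
    · rw [sub_nonneg, div_le_iff₀ hq]; linarith
    · ext j
      fin_cases j
      · simp; field_simp; ring
      · simp; field_simp

lemma mem_cone_e1 (p q : ℝ) (hp : p ≤ 0) (hpq : 0 < p + q) (x : Fin 2 → ℝ) :
    x ∈ coneTwo ![0, 1] ![p, q] ↔ x 0 ≤ 0 ∧ 0 ≤ x 1 ∧ p * x 1 ≤ q * x 0 := by
  have hq : 0 < q := by linarith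
  constructor
  · rintro ⟨a, b, ha, hb, rfl⟩
    simp
    refine ⟨?_, by positivity, ?_⟩
    · nlinarith
    · nlinarith
  · rintro ⟨h0, h1, h2⟩
    rcases hp.lt_or_eq with hp | hp
    · refine ⟨x 1 - q * x 0 / p, x 0 / p, ?_, div_nonneg_of_nonpos h0 hp.le, ?_⟩
      · rw [sub_nonneg, div_le_iff_of_neg hp]; linarith
      · have := hp.ne
        ext j
        fin_cases j
        · simp; field_simp
        · simp; field_simp; ring
    · subst hp
      have : x 0 = 0 := by nlinarith
      refine ⟨x 1, 0, h1, le_rfl, ?_⟩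
      ext j
      fin_cases j
      · simp [this]
      · simp

/-- Cutting off one unimodular triangle. -/
lemma subArea_step (p q : ℤ) (hp : p ≤ 0) (hpq : 0 < p + q) :
    subArea (coneTwo ![1, 0] ![(p : ℝ), q]) =
      ENNReal.ofReal (1 / 2) + subArea (coneTwo ![0, 1] ![(p : ℝ), q]) := by
  have hp' : (p : ℝ) ≤ 0 := by exact_mod_cast hp
  have hpq' : (0 : ℝ) < p + q := by exact_mod_cast hpq
  have hq' : (0 : ℝ) < q := by linarith
  set P : ℝ := (p : ℝ)
  set Q : ℝ := (q : ℝ)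
  set C := coneTwo ![1, 0] ![P, Q] with hC
  set C2 := coneTwo ![0, 1] ![P, Q] with hC2
  set K := convexHull ℝ ((C \ {0}) ∩ Lat2) with hK
  set K2 := convexHull ℝ ((C2 \ {0}) ∩ Lat2) with hK2
  have mC : ∀ x, x ∈ C ↔ 0 ≤ x 1 ∧ P * x 1 ≤ Q * x 0 := mem_cone_e0 P Q hq'
  have mC2 : ∀ x, x ∈ C2 ↔ x 0 ≤ 0 ∧ 0 ≤ x 1 ∧ P * x 1 ≤ Q * x 0 := mem_cone_e1 P Q hp' hpq'
  have hsub : C2 ⊆ C := fun x hx => (mC x).mpr ((mC2 x).mp hx).2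
  -- fact (ii)
  have hK2K : K2 ⊆ K := convexHull_mono
    (Set.inter_subset_inter_left _ (Set.diff_subset_diff_left hsub))
  -- fact (i)
  have hlat : ∀ x ∈ (C \ {0}) ∩ Lat2, 1 ≤ x 0 + x 1 := by
    rintro x ⟨⟨hxC, hx0⟩, hxL⟩
    obtain ⟨h1, h2⟩ := (mC x).mp hxC
    have hpos : 0 < x 0 + x 1 := by
      rcases h1.lt_or_eq with h | h
      · have : 0 < Q * (x 0 + x 1) := by nlinarith [mul_pos hpq' h]
        exact pos_of_mul_pos_right this hq'.le
      · rw [← h] at h2 ⊢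
        have h3 : 0 ≤ x 0 := by
          by_contra hneg
          push Not at hneg
          nlinarith
        rcases h3.lt_or_eq with h4 | h4
        · linarith
        · exfalso
          apply hx0
          ext j
          fin_cases j
          · exact h4.symm
          · exact h.symm
    obtain ⟨m, hm⟩ := hxL 0
    obtain ⟨n, hn⟩ := hxL 1
    rw [hm, hn] at hpos ⊢
    norm_cast at hpos ⊢
  have hKl : ∀ x ∈ K, 1 ≤ x 0 + x 1 := by
    have hconv : Convex ℝ {x : Fin 2 → ℝ | 1 ≤ x 0 + x 1} := by
      intro x hx y hy a b ha hb hab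
      simp only [Set.mem_setOf_eq, Pi.add_apply, Pi.smul_apply, smul_eq_mul] at *
      nlinarith
    exact fun x hx => convexHull_min hlat hconv hx
  have hK2C2 : K2 ⊆ C2 := by
    refine convexHull_min (fun x hx => hx.1.1) ?_
    intro x hx y hy a b ha hb hab
    rw [mC2] at *
    simp only [Pi.add_apply, Pi.smul_apply, smul_eq_mul]
    obtain ⟨x1, x2, x3⟩ := hx
    obtain ⟨y1, y2, y3⟩ := hy
    refine ⟨by nlinarith, by positivity, ?_⟩
    nlinarith [mul_le_mul_of_nonneg_left x3 ha, mul_le_mul_of_nonneg_left y3 hb]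
  -- multiples of the two basis vectors
  have hv2 : ∀ c : ℝ, 1 ≤ c → (![0, c] : Fin 2 → ℝ) ∈ K2 := by
    intro c hc
    have := smul_mem_hull ((C2 \ {0}) ∩ Lat2) ![0, 1] (by
      intro n hn
      have hn' : (1 : ℝ) ≤ n := by exact_mod_cast hn
      refine ⟨⟨?_, ?_⟩, ?_⟩
      · rw [mC2]
        simp
        nlinarith
      · intro h
        have := congrFun h 1
        simp at this
        omega
      · have := lat2_mk 0 n
        convert this using 1
        ext j
        fin_cases j <;> simp) c hc
    convert this using 1
    ext j
    fin_cases j <;> simp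
  have hu : ∀ c : ℝ, 1 ≤ c → (![c, 0] : Fin 2 → ℝ) ∈ K := by
    intro c hc
    have := smul_mem_hull ((C \ {0}) ∩ Lat2) ![1, 0] (by
      intro n hn
      have hn' : (1 : ℝ) ≤ n := by exact_mod_cast hn
      refine ⟨⟨?_, ?_⟩, ?_⟩
      · rw [mC]
        simp
        positivity
      · intro h
        have := congrFun h 0
        simp at this
        omega
      · have := lat2_mk n 0
        convert this using 1
        ext j
        fin_cases j <;> simp) c hc
    convert this using 1
    ext j
    fin_cases j <;> simp
  -- fact (iii)
  set T : Set (Fin 2 → ℝ) := {x | 0 ≤ x 0 ∧ 0 ≤ x 1 ∧ 1 ≤ x 0 + x 1} with hT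
  have hTK : T ⊆ K := by
    rintro x ⟨h0, h1, h2⟩
    have hne : x 0 + x 1 ≠ 0 := by linarith
    have := (convex_convexHull ℝ _) (hu _ h2) (hK2K (hv2 _ h2))
      (a := x 0 / (x 0 + x 1)) (b := x 1 / (x 0 + x 1))
      (by positivity) (by positivity) (by field_simp)
    convert this using 1
    ext j
    fin_cases j
    · simp; field_simp
    · simp; field_simp
  have hTK2 : ∀ x ∈ T, x 0 ≤ 0 → x ∈ K2 := by
    rintro x ⟨h0, h1, h2⟩ h3
    have h4 : x 0 = 0 := le_antisymm h3 h0
    have := hv2 (x 1) (by linarith)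
    convert this using 1
    ext j
    fin_cases j
    · exact h4
    · rfl
  have hTconv : Convex ℝ T := by
    rintro x ⟨x0, x1, x2⟩ y ⟨y0, y1, y2⟩ a b ha hb hab
    refine ⟨?_, ?_, ?_⟩ <;> simp only [Pi.add_apply, Pi.smul_apply, smul_eq_mul]
    · positivity
    · positivity
    · nlinarith
  have mixed : ∀ x ∈ T, ∀ y ∈ K2, ∀ a b : ℝ, 0 ≤ a → 0 ≤ b → a + b = 1 →
      a • x + b • y ∈ T ∪ K2 := by
    rintro x ⟨x0, x1, x2⟩ y hy a b ha hb hab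
    obtain ⟨y0, y1, y3⟩ := (mC2 y).mp (hK2C2 hy)
    have y2 := hKl y (hK2K hy)
    by_cases hz : 0 ≤ a * x 0 + b * y 0
    · left
      refine ⟨?_, ?_, ?_⟩ <;> simp only [Pi.add_apply, Pi.smul_apply, smul_eq_mul]
      · exact hz
      · positivity
      · nlinarith
    · right
      push Not at hz
      have hy0 : y 0 < 0 := by
        rcases y0.lt_or_eq with h | h
        · exact h
        · rw [h] at hz
          nlinarith [mul_nonneg ha x0]
      have hxy : 0 < x 0 - y 0 := by linarith
      have hm : (![0, (-y 0 * x 1 + x 0 * y 1) / (x 0 - y 0)] : Fin 2 → ℝ) ∈ K2 := by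
        apply hv2
        rw [le_div_iff₀ hxy]
        nlinarith
      have hs : 0 ≤ (a * x 0 + b * y 0) / y 0 := div_nonneg_of_nonpos hz.le hy0.le
      have hs1 : (a * x 0 + b * y 0) / y 0 ≤ 1 := by
        rw [div_le_iff_of_neg hy0]
        nlinarith [mul_nonneg ha x0]
      have := (convex_convexHull ℝ _) hm hy (a := 1 - (a * x 0 + b * y 0) / y 0)
        (b := (a * x 0 + b * y 0) / y 0) (by linarith) hs (by ring)
      convert this using 1
      have hb' : b = 1 - a := by linarith
      subst hb'
      have hne := hy0.ne
      have hne2 := hxy.ne'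
      ext j
      fin_cases j
      · simp; field_simp
      · simp; field_simp; ring
  -- fact (iv)
  have hKsub : K ⊆ T ∪ K2 := by
    refine convexHull_min ?_ ?_
    · rintro x hx
      have hl := hlat x hx
      obtain ⟨h1, h2⟩ := (mC x).mp hx.1.1
      by_cases h0 : 0 ≤ x 0
      · exact Or.inl ⟨h0, h1, hl⟩
      · right
        push Not at h0
        exact subset_convexHull ℝ _ ⟨⟨(mC2 x).mpr ⟨h0.le, h1, h2⟩, hx.1.2⟩, hx.2⟩
    · rintro x (hx | hx) y (hy | hy) a b ha hb hab
      · exact Or.inl (hTconv hx hy ha hb hab)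
      · exact mixed x hx y hy a b ha hb hab
      · rw [add_comm]
        exact mixed y hy x hx b a hb ha (by linarith)
      · exact Or.inr ((convex_convexHull ℝ _) hx hy ha hb hab)
  have hdecomp : C \ K = {x : Fin 2 → ℝ | 0 < x 0 ∧ 0 ≤ x 1 ∧ x 0 + x 1 < 1} ∪ (C2 \ K2) := by
    ext x
    constructor
    · rintro ⟨hxC, hxK⟩
      obtain ⟨h1, h2⟩ := (mC x).mp hxC
      by_cases h0 : 0 < x 0
      · left
        refine ⟨h0, h1, ?_⟩
        by_contra h
        push Not at h
        exact hxK (hTK ⟨h0.le, h1, h⟩)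
      · right
        push Not at h0
        exact ⟨(mC2 x).mpr ⟨h0, h1, h2⟩, fun h => hxK (hK2K h)⟩
    · rintro (⟨h0, h1, h2⟩ | ⟨hxC, hxK⟩)
      · refine ⟨(mC x).mpr ⟨h1, ?_⟩, fun h => ?_⟩
        · nlinarith [mul_pos hq' h0]
        · linarith [hKl x h]
      · refine ⟨hsub hxC, fun h => ?_⟩
        rcases hKsub h with h | h
        · exact hxK (hTK2 x h ((mC2 x).mp hxC).1)
        · exact hxK h
  unfold subArea
  rw [hdecomp, measure_union' _ meas_tri, vol_tri]
  rw [Set.disjoint_left]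
  rintro x ⟨h0, _, _⟩ ⟨hxC, _⟩
  exact absurd ((mC2 x).mp hxC).1 (not_le.mpr h0)

lemma zbasis_mk (a b c e : ℤ) (h : a * e - b * c = 1 ∨ a * e - b * c = -1) :
    IsZBasis ![(a : ℝ), (c : ℝ)] ![(b : ℝ), (e : ℝ)] := by
  refine ⟨lat2_mk _ _, lat2_mk _ _, ?_⟩
  intro x hx
  obtain ⟨m, hm⟩ := hx 0
  obtain ⟨n, hn⟩ := hx 1
  set D := a * e - b * c with hD
  have hDD : D * D = 1 := by rcases h with h | h <;> rw [h] <;> norm_num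
  refine ⟨D * (e * m - b * n), D * (a * n - c * m), ?_⟩
  ext j
  fin_cases j
  · have : m = D * (e * m - b * n) * a + D * (a * n - c * m) * b := by
      linear_combination (-m) * hDD + m * D * hD
    simp [hm]
    exact_mod_cast this
  · have : n = D * (e * m - b * n) * c + D * (a * n - c * m) * e := by
      linear_combination (-n) * hDD + n * D * hD
    simp [hn]
    exact_mod_cast this

/-- Area attached to the normal form `(d,k)`. -/
noncomputable def ga (d k : ℤ) : ENNReal := subArea (coneTwo ![1, 0] ![(k : ℝ), (d : ℝ)])

lemma ga_of_basis (e₁ e₂ : Fin 2 → ℝ) (hB : IsZBasis e₁ e₂) (d k : ℤ) :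
    subArea (coneTwo e₁ ((k : ℝ) • e₁ + (d : ℝ) • e₂)) = ga d k := by
  have := subArea_basis e₁ e₂ hB 1 0 k d
  rw [one_smul, zero_smul, add_zero] at this
  exact this

lemma ga_shear (d k : ℤ) : ga d (k + d) = ga d k := by
  have := ga_of_basis _ _ (zbasis_mk 1 1 0 1 (by norm_num)) d k
  rw [← this, ga]
  congr 2
  · simp
  · ext j
    fin_cases j <;> simp

lemma ga_step (d k : ℤ) (hk : 0 < k) (hkd : k ≤ d) :
    ga d k = ENNReal.ofReal (1 / 2) + ga (d - k) k := by
  have h := subArea_step (k - d) d (by linarith) (by linarith)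
  have h1 := ga_of_basis _ _ (zbasis_mk 1 (-1) 0 1 (by norm_num)) d k
  have h2 := ga_of_basis _ _ (zbasis_mk 0 (-1) 1 1 (by norm_num)) (d - k) k
  rw [← h1, ← h2]
  have v1 : ((k : ℝ) • ![((1 : ℤ) : ℝ), ((0 : ℤ) : ℝ)] +
      (d : ℝ) • ![((-1 : ℤ) : ℝ), ((1 : ℤ) : ℝ)]) = ![((k - d : ℤ) : ℝ), (d : ℝ)] := by
    ext j
    fin_cases j
    · simp; ring
    · simp
  have v2 : ((k : ℝ) • ![((0 : ℤ) : ℝ), ((1 : ℤ) : ℝ)] +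
      ((d - k : ℤ) : ℝ) • ![((-1 : ℤ) : ℝ), ((1 : ℤ) : ℝ)]) = ![((k - d : ℤ) : ℝ), (d : ℝ)] := by
    ext j
    fin_cases j <;> simp
  rw [v1, v2]
  simpa only [Int.cast_one, Int.cast_zero] using h

lemma ga_zero : ga 0 1 = 0 := by
  have h := ga_of_basis _ _ (zbasis_mk 1 0 0 1 (by norm_num)) 0 1
  rw [← h]
  unfold subArea
  refine measure_mono_null Set.diff_subset ?_
  have hsub : coneTwo ![((1 : ℤ) : ℝ), ((0 : ℤ) : ℝ)]
      (((1 : ℤ) : ℝ) • ![((1 : ℤ) : ℝ), ((0 : ℤ) : ℝ)] +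
        ((0 : ℤ) : ℝ) • ![((0 : ℤ) : ℝ), ((1 : ℤ) : ℝ)]) ⊆
      (LinearMap.ker (LinearMap.proj 1 : (Fin 2 → ℝ) →ₗ[ℝ] ℝ) : Set (Fin 2 → ℝ)) := by
    rintro x ⟨a, b, _, _, rfl⟩
    simp
  refine measure_mono_null hsub (Measure.addHaar_submodule _ _ ?_)
  intro htop
  have : (![0, 1] : Fin 2 → ℝ) ∈ LinearMap.ker (LinearMap.proj 1 : (Fin 2 → ℝ) →ₗ[ℝ] ℝ) := by
    rw [htop]; trivial
  simp at this

/-- Normalized real version. -/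
def IsRsv (d k : ℤ) (c : ℝ) : Prop := ga d k ≠ ⊤ ∧ 2 * (ga d k).toReal = c

lemma isRsv_step (d k : ℤ) (hk : 0 < k) (hkd : k ≤ d) (c : ℝ) :
    IsRsv d k (1 + c) ↔ IsRsv (d - k) k c := by
  unfold IsRsv
  rw [ga_step d k hk hkd]
  by_cases h : ga (d - k) k = ⊤
  · simp [h]
  · rw [ENNReal.toReal_add ENNReal.ofReal_ne_top h, ENNReal.toReal_ofReal (by norm_num)]
    simp only [ne_eq, ENNReal.add_eq_top, ENNReal.ofReal_ne_top, h, or_self, not_false_eq_true,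
      true_and]
    constructor <;> intro h <;> linarith

lemma isRsv_steps (k : ℤ) (hk : 0 < k) (n : ℕ) : ∀ (d : ℤ) (c : ℝ), n * k ≤ d →
    IsRsv (d - n * k) k c → IsRsv d k (n + c) := by
  induction n with
  | zero => intro d c _ h; simpa using h
  | succ n ih =>
    intro d c hd h
    push_cast at hd h ⊢
    have hnk : (0 : ℤ) ≤ n * k := by positivity
    have h2 : IsRsv (d - n * k) k (1 + c) := by
      rw [isRsv_step _ _ hk (by linarith)]
      convert h using 1
      ring
    have := ih d (1 + c) (by linarith) h2
    convert this using 1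
    ring

/-- The sum of `b - 2` over a list of naturals. -/
def hjSum (l : List ℕ) : ℝ := (l.map (fun b : ℕ => (b : ℝ) - 2)).sum

lemma isRsv_main (k : ℕ) : ∀ d : ℕ, 0 < k → k ≤ d → Nat.Coprime d k →
    IsRsv d k (2 + hjSum (hjList d k)) := by
  induction k using Nat.strong_induction_on with
  | _ k ih =>
  intro d hk hkd hco
  rw [hjList]
  split_ifs with h1
  · have hk1 : k = 1 := by omega
    subst hk1
    have h0 : IsRsv ((d : ℤ) - d * ((1 : ℕ) : ℤ)) ((1 : ℕ) : ℤ) 0 := by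
      simp [IsRsv, ga_zero]
    have := isRsv_steps ((1 : ℕ) : ℤ) (by norm_num) d d 0 (by simp) h0
    simpa [hjSum] using this
  · push Not at h1
    generalize hb : (d + k - 1) / k = b
    have hb1 : b * k ≤ d + k - 1 := hb ▸ Nat.div_mul_le_self _ _
    have hb2 : d + k - 1 < b * k + k := by
      have := Nat.lt_div_mul_add (a := d + k - 1) hk
      rwa [hb] at this
    have hne : b * k ≠ d := by
      intro h
      have hdvd : k ∣ d := ⟨b, by rw [← h, mul_comm]⟩
      have := Nat.Coprime.eq_one_of_dvd hco.symm hdvd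
      omega
    obtain ⟨n, rfl : b = n + 1⟩ : ∃ n, b = n + 1 := by
      refine ⟨b - 1, ?_⟩
      have : b ≠ 0 := by
        intro h
        rw [h, zero_mul] at hb2
        omega
      omega
    set k2 := (n + 1) * k - d with hk2
    have e1 : (n + 1) * k = n * k + k := by ring
    have hk2d : k2 + d = (n + 1) * k := by omega
    have hk2pos : 0 < k2 := by omega
    have hk2lt : k2 < k := by omega
    have hco2 : Nat.Coprime k k2 := by
      have hg1 : Nat.gcd k k2 ∣ k := Nat.gcd_dvd_left _ _
      have hg2 : Nat.gcd k k2 ∣ k2 := Nat.gcd_dvd_right _ _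
      have hg3 : Nat.gcd k k2 ∣ d := by
        rw [← Nat.dvd_add_right hg2, hk2d]
        exact Dvd.dvd.mul_left hg1 _
      have := Nat.dvd_gcd hg3 hg1
      rw [hco] at this
      exact Nat.dvd_one.mp this
    have h2 := ih k2 hk2lt k hk2pos hk2lt.le hco2
    set s := hjSum (hjList k k2) with hs
    have hk2dZ : (k2 : ℤ) + d = (n + 1) * k := by exact_mod_cast hk2d
    have h3 : IsRsv ((k : ℤ) - k2) k2 (1 + s) := by
      rw [← isRsv_step _ _ (by exact_mod_cast hk2pos) (by exact_mod_cast hk2lt.le)]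
      convert h2 using 1
      ring
    have h4 : IsRsv ((d : ℤ) - n * k) k (1 + s) := by
      unfold IsRsv at h3 ⊢
      rw [← ga_shear] at h3
      have q1 : (k : ℤ) - k2 = d - n * k := by linarith
      have q2 : (k2 : ℤ) + (d - n * k) = k := by linarith
      rw [q1, q2] at h3
      exact h3
    have h5 := isRsv_steps k (by exact_mod_cast hk) n d (1 + s)
      (by
        have : n * k ≤ d := by omega
        exact_mod_cast this) h4
    rw [hjSum, List.map_cons, List.sum_cons, ← hjSum, ← hs]
    convert h5 using 1
    push_cast
    ring

/-- for a `(d,k)`-cone `σ` with `d/k = [b₁,…,b_r]⁻`, the normalized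
relative subdiagram volume is `RSV(σ) = 2 + Σᵢ (bᵢ − 2)`; equivalently the local Euler
obstruction `Eu = 2 − RSV(σ)` equals `Σᵢ (2 − bᵢ)`. -/
theorem rsv_of_dk_cone (d k : ℕ) (hk : 0 < k) (hd : k < d) (hco : Nat.Coprime d k)
    (e₁ e₂ : Fin 2 → ℝ) (hB : IsZBasis e₁ e₂) :
    RSV (coneTwo e₁ ((k : ℝ) • e₁ + (d : ℝ) • e₂))
        = 2 + ((hjList d k).map (fun b => (b : ℝ) - 2)).sum ∧
      2 - RSV (coneTwo e₁ ((k : ℝ) • e₁ + (d : ℝ) • e₂))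
        = ((hjList d k).map (fun b => 2 - (b : ℝ))).sum := by
  have h := isRsv_main k d hk hd.le hco
  have hg := ga_of_basis e₁ e₂ hB d k
  have hcast : ∀ l : List ℕ, (do let a ← l; pure (a : ℝ) : List ℝ) =
      l.map (fun a : ℕ => (a : ℝ)) := by
    intro l
    induction l with
    | nil => rfl
    | cons a l ih =>
      simp only [List.bind_eq_flatMap, List.pure_def, List.flatMap_cons] at ih ⊢
      simp [ih]
  have hR : RSV (coneTwo e₁ ((k : ℝ) • e₁ + (d : ℝ) • e₂)) = 2 + hjSum (hjList d k) := by
    rw [← h.2, ← hg]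
    simp [RSV, subArea]
  have hneg : ∀ l : List ℕ, ((l.map (fun a : ℕ => (a : ℝ))).map (fun b => 2 - b)).sum =
      - hjSum l := by
    intro l
    unfold hjSum
    induction l with
    | nil => simp
    | cons a l ih => simp only [List.map_cons, List.sum_cons, ih]; ring
  have hpos : ∀ l : List ℕ, ((l.map (fun a : ℕ => (a : ℝ))).map (fun b => b - 2)).sum =
      hjSum l := by
    intro l
    rw [hjSum, List.map_map]
    rfl
  rw [hR, hcast]
  refine ⟨?_, ?_⟩
  · rw [hpos]
  · rw [hneg]
    ring
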